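/- (General solution of the Schrödinger equation.) Every twice differentiable function u : (0,a) → ℂ satisfying −u''(x) + q(x) u(x) = 0 on (0,a) has the form u = c₁ u₁ + c₂ u₂ for unique complex constants c₁, c₂; conversely, for all c₁, c₂ ∈ ℂ the function c₁ u₁ + c₂ u₂ satisfies −u'' + q u = 0 on (0,a). -/

import Mathlib

open MeasureTheory Set Filter

/-- The sequence X̃^(n): X̃^(0) ≡ 1; for n ≥ 1, X̃^(n)(x) = n ∫₀ˣ X̃^(n-1)(ξ) dξ
if n is even, and X̃^(n)(x) = n ∫₀ˣ X̃^(n-1)(ξ) q(ξ) dξ if n is odd. -/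
noncomputable def Xtilde (q : ℝ → ℂ) : ℕ → ℝ → ℂ
  | 0 => fun _ => 1
  | n + 1 => fun x => ((n + 1 : ℕ) : ℂ) *
      ∫ ξ in (0:ℝ)..x, Xtilde q n ξ * (if Even (n + 1) then 1 else q ξ)

/-- The sequence X^(n): X^(0) ≡ 1; for n ≥ 1, X^(n)(x) = n ∫₀ˣ X^(n-1)(ξ) q(ξ) dξ
if n is even, and X^(n)(x) = n ∫₀ˣ X^(n-1)(ξ) dξ if n is odd. -/
noncomputable def Xup (q : ℝ → ℂ) : ℕ → ℝ → ℂ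
  | 0 => fun _ => 1
  | n + 1 => fun x => ((n + 1 : ℕ) : ℂ) *
      ∫ ξ in (0:ℝ)..x, Xup q n ξ * (if Even (n + 1) then q ξ else 1)

/-- u₁(x) = Σ_{even n ≥ 0} X̃^(n)(x)/n!, written as a sum over even indices n = 2k. -/
noncomputable def u₁ (q : ℝ → ℂ) (x : ℝ) : ℂ :=
  ∑' k : ℕ, Xtilde q (2 * k) x / (Nat.factorial (2 * k) : ℂ)

/-- u₂(x) = Σ_{odd n ≥ 1} X^(n)(x)/n!, written as a sum over odd indices n = 2k+1. -/
noncomputable def u₂ (q : ℝ → ℂ) (x : ℝ) : ℂ :=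
  ∑' k : ℕ, Xup q (2 * k + 1) x / (Nat.factorial (2 * k + 1) : ℂ)

/-- Normalized iterated integrals with alternating weights. -/
noncomputable def FF (α β : ℝ → ℂ) : ℕ → ℝ → ℂ
  | 0 => fun _ => 1
  | n + 1 => fun x => ∫ ξ in (0:ℝ)..x, FF α β n ξ * (if Even n then α ξ else β ξ)

theorem FF_cont {α β : ℝ → ℂ} (hα : Continuous α) (hβ : Continuous β) (n : ℕ) :
    Continuous (FF α β n) := by
  induction n with
  | zero => exact continuous_const
  | succ n ih =>
    have : Continuous (fun ξ => FF α β n ξ * (if Even n then α ξ else β ξ)) := by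
      by_cases h : Even n <;> simp only [h, if_true, if_false] <;> fun_prop
    exact intervalIntegral.continuous_primitive (fun _ _ => this.intervalIntegrable _ _) 0

theorem FF_deriv {α β : ℝ → ℂ} (hα : Continuous α) (hβ : Continuous β) (n : ℕ) (x : ℝ) :
    HasDerivAt (FF α β (n+1)) (FF α β n x * (if Even n then α x else β x)) x := by
  have hc := FF_cont hα hβ n
  have : Continuous (fun ξ => FF α β n ξ * (if Even n then α ξ else β ξ)) := by
    by_cases h : Even n <;> simp only [h, if_true, if_false] <;> fun_prop
  exact intervalIntegral.integral_hasDerivAt_right (this.intervalIntegrable _ _)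
    this.stronglyMeasurable.stronglyMeasurableAtFilter this.continuousAt

theorem FF_bound {α β : ℝ → ℂ} {a M : ℝ} (hM : 0 ≤ M)
    (hα' : ∀ x ∈ Icc 0 a, ‖α x‖ ≤ M) (hβ' : ∀ x ∈ Icc 0 a, ‖β x‖ ≤ M) (n : ℕ) :
    ∀ x ∈ Icc 0 a, ‖FF α β n x‖ ≤ (M * x) ^ n / n.factorial := by
  induction n with
  | zero => intro x _; simp [FF]
  | succ n ih =>
    intro x hx
    have h1 : ‖FF α β (n+1) x‖ ≤ ∫ t in (0:ℝ)..x, (M * t) ^ n / n.factorial * M := by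
      apply intervalIntegral.norm_integral_le_of_norm_le hx.1
      · refine Eventually.of_forall fun t ht => ?_
        have ht' : t ∈ Icc 0 a := ⟨ht.1.le, ht.2.trans hx.2⟩
        rw [norm_mul]
        have h2 : ‖(if Even n then α t else β t)‖ ≤ M := by
          split_ifs
          · exact hα' t ht'
          · exact hβ' t ht'
        have h3 := ih t ht'
        have h4 := (norm_nonneg _).trans h3
        gcongr
      · exact Continuous.intervalIntegrable (by fun_prop) _ _
    refine h1.trans (le_of_eq ?_)
    simp_rw [mul_pow]
    have : ∀ t : ℝ, M ^ n * t ^ n / n.factorial * M = M ^ (n+1) / n.factorial * t ^ n := by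
      intro t; ring
    simp_rw [this]
    rw [intervalIntegral.integral_const_mul, integral_pow, Nat.factorial_succ]
    push_cast
    field_simp
    simp

theorem bb_summable (r : ℝ) : Summable (fun n : ℕ => r ^ n / n.factorial) :=
  Real.summable_pow_div_factorial r

noncomputable def SS (α β : ℝ → ℂ) (x : ℝ) : ℂ := ∑' k : ℕ, FF α β (2 * k) x
noncomputable def TT (α β : ℝ → ℂ) (x : ℝ) : ℂ := ∑' k : ℕ, FF α β (2 * k + 1) x

section
variable {α β : ℝ → ℂ} {a M : ℝ}

theorem FF_bound' (hM : 0 ≤ M)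
    (hα' : ∀ x ∈ Icc 0 a, ‖α x‖ ≤ M) (hβ' : ∀ x ∈ Icc 0 a, ‖β x‖ ≤ M) (n : ℕ)
    (x : ℝ) (hx : x ∈ Icc 0 a) : ‖FF α β n x‖ ≤ (M * a) ^ n / n.factorial := by
  refine (FF_bound hM hα' hβ' n x hx).trans ?_
  have := hx.1
  have := hx.2
  gcongr

theorem sum_even (r : ℝ) : Summable (fun k : ℕ => r ^ (2 * k) / (2 * k).factorial) :=
  (bb_summable r).comp_injective (i := fun k : ℕ => 2 * k) (fun x y h => by simpa using h)

theorem sum_odd (r : ℝ) : Summable (fun k : ℕ => r ^ (2 * k + 1) / (2 * k + 1).factorial) :=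
  (bb_summable r).comp_injective (i := fun k : ℕ => 2 * k + 1) (fun x y h => by simpa using h)

theorem SS_cont (hα : Continuous α) (hβ : Continuous β) (hM : 0 ≤ M)
    (hα' : ∀ x ∈ Icc 0 a, ‖α x‖ ≤ M) (hβ' : ∀ x ∈ Icc 0 a, ‖β x‖ ≤ M) :
    ContinuousOn (SS α β) (Icc 0 a) :=
  continuousOn_tsum (fun k => (FF_cont hα hβ (2 * k)).continuousOn) (sum_even (M * a))
    (fun k x hx => FF_bound' hM hα' hβ' (2 * k) x hx)

theorem TT_cont (hα : Continuous α) (hβ : Continuous β) (hM : 0 ≤ M)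
    (hα' : ∀ x ∈ Icc 0 a, ‖α x‖ ≤ M) (hβ' : ∀ x ∈ Icc 0 a, ‖β x‖ ≤ M) :
    ContinuousOn (TT α β) (Icc 0 a) :=
  continuousOn_tsum (fun k => (FF_cont hα hβ (2 * k + 1)).continuousOn) (sum_odd (M * a))
    (fun k x hx => FF_bound' hM hα' hβ' (2 * k + 1) x hx)

theorem FF_zero (n : ℕ) : FF α β (n + 1) 0 = 0 := by simp [FF]

theorem TT_zero : TT α β 0 = 0 := by simp [TT, FF_zero]

theorem SS_zero : SS α β 0 = 1 := by
  unfold SS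
  rw [tsum_eq_single 0]
  · simp [FF]
  · intro k hk
    obtain ⟨m, rfl⟩ := Nat.exists_eq_succ_of_ne_zero hk
    exact FF_zero (2 * m + 1)

theorem TT_deriv (hα : Continuous α) (hβ : Continuous β) (hM : 0 ≤ M)
    (hα' : ∀ x ∈ Icc 0 a, ‖α x‖ ≤ M) (hβ' : ∀ x ∈ Icc 0 a, ‖β x‖ ≤ M)
    (x : ℝ) (hx : x ∈ Ioo 0 a) : HasDerivAt (TT α β) (SS α β x * α x) x := by
  have h := hasDerivAt_tsum_of_isPreconnected (t := Ioo 0 a)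
    (g := fun k : ℕ => FF α β (2 * k + 1)) (g' := fun k y => FF α β (2 * k) y * α y)
    (u := fun k : ℕ => (M * a) ^ (2 * k) / (2 * k).factorial * M)
    (y₀ := x) (y := x)
    ((sum_even (M * a)).mul_right M) isOpen_Ioo isPreconnected_Ioo
    (fun k y _ => by simpa using FF_deriv hα hβ (2 * k) y)
    (fun k y hy => by
      have hy' := Ioo_subset_Icc_self hy
      have h1 := FF_bound' hM hα' hβ' (2 * k) y hy'
      have h4 := (norm_nonneg _).trans h1
      rw [norm_mul]
      have := hα' y hy'
      gcongr)
    hx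
    (Summable.of_norm_bounded (sum_odd (M * a))
      (fun k => FF_bound' hM hα' hβ' (2 * k + 1) x (Ioo_subset_Icc_self hx)))
    hx
  rw [tsum_mul_right] at h
  exact h

theorem SS_deriv (hα : Continuous α) (hβ : Continuous β) (hM : 0 ≤ M)
    (hα' : ∀ x ∈ Icc 0 a, ‖α x‖ ≤ M) (hβ' : ∀ x ∈ Icc 0 a, ‖β x‖ ≤ M)
    (x : ℝ) (hx : x ∈ Ioo 0 a) : HasDerivAt (SS α β) (TT α β x * β x) x := by
  have hs : ∀ y ∈ Ioo 0 a, Summable (fun k : ℕ => FF α β (2 * k) y) := fun y hy =>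
    (Summable.of_norm_bounded (sum_even (M * a))
      (fun k => FF_bound' hM hα' hβ' (2 * k) y (Ioo_subset_Icc_self hy)))
  have hs2 : ∀ y ∈ Ioo 0 a, Summable (fun k : ℕ => FF α β (2 * k + 1 + 1) y) := fun y hy =>
    (hs y hy).comp_injective (i := fun k : ℕ => k + 1) (fun x y h => by simpa using h)
  have hsum : ∀ y ∈ Ioo 0 a, SS α β y = 1 + ∑' k : ℕ, FF α β (2 * k + 1 + 1) y := by
    intro y hy
    unfold SS
    rw [(hs y hy).tsum_eq_zero_add]
    congr 1
  have h := hasDerivAt_tsum_of_isPreconnected (t := Ioo 0 a)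
    (g := fun k : ℕ => FF α β (2 * k + 1 + 1)) (g' := fun k y => FF α β (2 * k + 1) y * β y)
    (u := fun k : ℕ => (M * a) ^ (2 * k + 1) / (2 * k + 1).factorial * M)
    (y₀ := x) (y := x)
    ((sum_odd (M * a)).mul_right M) isOpen_Ioo isPreconnected_Ioo
    (fun k y _ => by
      have := FF_deriv hα hβ (2 * k + 1) y
      have hne : ¬ Even (2 * k + 1) := by simp
      rw [if_neg hne] at this
      exact this)
    (fun k y hy => by
      have hy' := Ioo_subset_Icc_self hy
      have h1 := FF_bound' hM hα' hβ' (2 * k + 1) y hy'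
      have h4 := (norm_nonneg _).trans h1
      rw [norm_mul]
      have := hβ' y hy'
      gcongr)
    hx
    (hs2 x hx)
    hx
  rw [tsum_mul_right] at h
  refine (h.const_add 1).congr_of_eventuallyEq ?_
  filter_upwards [isOpen_Ioo.mem_nhds hx] with y hy
  exact hsum y hy

end

theorem Xt_eq {q Q : ℝ → ℂ} {a : ℝ} (h : ∀ x ∈ Icc 0 a, q x = Q x) (n : ℕ) :
    ∀ x ∈ Icc 0 a, Xtilde q n x / (n.factorial : ℂ) = FF Q (fun _ => 1) n x := by
  induction n with
  | zero => intro x _; simp [Xtilde, FF]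
  | succ n ih =>
    intro x hx
    have : ∫ ξ in (0:ℝ)..x, Xtilde q n ξ * (if Even (n + 1) then 1 else q ξ)
        = ∫ ξ in (0:ℝ)..x, (n.factorial : ℂ) *
          (FF Q (fun _ => 1) n ξ * (if Even n then Q ξ else 1)) := by
      apply intervalIntegral.integral_congr
      intro t ht
      rw [uIcc_of_le hx.1] at ht
      have ht' : t ∈ Icc 0 a := ⟨ht.1, ht.2.trans hx.2⟩
      have hf : (n.factorial : ℂ) ≠ 0 := by exact_mod_cast n.factorial_ne_zero
      simp only [← ih t ht', h t ht', Nat.even_add_one]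
      by_cases he : Even n <;> simp [he] <;> field_simp
    simp only [Xtilde, FF]
    rw [this, intervalIntegral.integral_const_mul, Nat.factorial_succ]
    have hf : (n.factorial : ℂ) ≠ 0 := by exact_mod_cast n.factorial_ne_zero
    have hn : ((n : ℂ) + 1) ≠ 0 := by exact_mod_cast n.succ_ne_zero
    push_cast
    field_simp

theorem Xu_eq {q Q : ℝ → ℂ} {a : ℝ} (h : ∀ x ∈ Icc 0 a, q x = Q x) (n : ℕ) :
    ∀ x ∈ Icc 0 a, Xup q n x / (n.factorial : ℂ) = FF (fun _ => 1) Q n x := by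
  induction n with
  | zero => intro x _; simp [Xup, FF]
  | succ n ih =>
    intro x hx
    have : ∫ ξ in (0:ℝ)..x, Xup q n ξ * (if Even (n + 1) then q ξ else 1)
        = ∫ ξ in (0:ℝ)..x, (n.factorial : ℂ) *
          (FF (fun _ => 1) Q n ξ * (if Even n then 1 else Q ξ)) := by
      apply intervalIntegral.integral_congr
      intro t ht
      rw [uIcc_of_le hx.1] at ht
      have ht' : t ∈ Icc 0 a := ⟨ht.1, ht.2.trans hx.2⟩
      have hf : (n.factorial : ℂ) ≠ 0 := by exact_mod_cast n.factorial_ne_zero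
      simp only [← ih t ht', h t ht', Nat.even_add_one]
      by_cases he : Even n <;> simp [he] <;> field_simp
    simp only [Xup, FF]
    rw [this, intervalIntegral.integral_const_mul, Nat.factorial_succ]
    have hf : (n.factorial : ℂ) ≠ 0 := by exact_mod_cast n.factorial_ne_zero
    have hn : ((n : ℂ) + 1) ≠ 0 := by exact_mod_cast n.succ_ne_zero
    push_cast
    field_simp

theorem const_of_deriv {a : ℝ} {f : ℝ → ℂ} (hf : ∀ x ∈ Ioo 0 a, HasDerivAt f 0 x) :
    ∀ x ∈ Ioo 0 a, ∀ y ∈ Ioo 0 a, f x = f y := by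
  intro x hx y hy
  exact isOpen_Ioo.is_const_of_deriv_eq_zero isPreconnected_Ioo
    (fun z hz => (hf z hz).differentiableAt.differentiableWithinAt)
    (fun z hz => (hf z hz).deriv) hx hy

theorem key (a : ℝ) (ha : 0 < a) (q : ℝ → ℂ) (hq : ContinuousOn q (Set.Icc 0 a)) :
    ∃ d₁ d₂ : ℝ → ℂ,
      (∀ x ∈ Ioo 0 a, HasDerivAt (u₁ q) (d₁ x) x) ∧
      (∀ x ∈ Ioo 0 a, HasDerivAt (u₂ q) (d₂ x) x) ∧
      (∀ x ∈ Ioo 0 a, HasDerivAt d₁ (q x * u₁ q x) x) ∧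
      (∀ x ∈ Ioo 0 a, HasDerivAt d₂ (q x * u₂ q x) x) ∧
      (∀ x ∈ Ioo 0 a, u₁ q x * d₂ x - d₁ x * u₂ q x = 1) := by
  obtain ⟨C, hC⟩ := isCompact_Icc.exists_bound_of_continuousOn hq
  set M := max C 1 with hMdef
  have hM : 0 ≤ M := zero_le_one.trans (le_max_right _ _)
  set Q : ℝ → ℂ := IccExtend ha.le ((Icc 0 a).domRestrict q) with hQdef
  have hQ : Continuous Q := (continuousOn_iff_continuous_domRestrict.1 hq).Icc_extend'
  have hqQ : ∀ x ∈ Icc 0 a, q x = Q x := fun x hx => by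
    rw [hQdef, IccExtend_of_mem _ _ hx]; rfl
  have hQM : ∀ x ∈ Icc 0 a, ‖Q x‖ ≤ M := fun x hx => by
    rw [← hqQ x hx]; exact (hC x hx).trans (le_max_left _ _)
  have h1M : ∀ x ∈ Icc 0 a, ‖(fun _ : ℝ => (1:ℂ)) x‖ ≤ M := fun x hx => by
    simp [hMdef]
  have hc : Continuous (fun _ : ℝ => (1:ℂ)) := continuous_const
  have e1 : ∀ x ∈ Icc 0 a, u₁ q x = SS Q (fun _ => 1) x := fun x hx =>
    tsum_congr fun k => Xt_eq hqQ (2 * k) x hx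
  have e2 : ∀ x ∈ Icc 0 a, u₂ q x = TT (fun _ => 1) Q x := fun x hx =>
    tsum_congr fun k => Xu_eq hqQ (2 * k + 1) x hx
  have sub : Ioo 0 a ⊆ Icc 0 a := Ioo_subset_Icc_self
  have D1 := SS_deriv hQ hc hM hQM h1M
  have D1' := TT_deriv hQ hc hM hQM h1M
  have D2 := TT_deriv hc hQ hM h1M hQM
  have D2' := SS_deriv hc hQ hM h1M hQM
  refine ⟨TT Q (fun _ => 1), SS (fun _ => 1) Q, ?_, ?_, ?_, ?_, ?_⟩
  · intro x hx
    refine HasDerivAt.congr_of_eventuallyEq (f := SS Q (fun _ => 1)) (by simpa using D1 x hx) ?_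
    filter_upwards [isOpen_Ioo.mem_nhds hx] with y hy using e1 y (sub hy)
  · intro x hx
    refine HasDerivAt.congr_of_eventuallyEq (f := TT (fun _ => 1) Q) (by simpa using D2 x hx) ?_
    filter_upwards [isOpen_Ioo.mem_nhds hx] with y hy using e2 y (sub hy)
  · intro x hx
    rw [hqQ x (sub hx), e1 x (sub hx), mul_comm]
    exact D1' x hx
  · intro x hx
    rw [hqQ x (sub hx), e2 x (sub hx), mul_comm]
    exact D2' x hx
  · intro x hx
    rw [e1 x (sub hx), e2 x (sub hx)]
    set W : ℝ → ℂ := fun x => SS Q (fun _ => 1) x * SS (fun _ => 1) Q x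
      - TT Q (fun _ => 1) x * TT (fun _ => 1) Q x with hW
    have hWd : ∀ y ∈ Ioo 0 a, HasDerivAt W 0 y := by
      intro y hy
      have := ((D1 y hy).mul (D2' y hy)).sub ((D1' y hy).mul (D2 y hy))
      refine HasDerivAt.congr_deriv this ?_
      ring
    have hWc : ContinuousOn W (Icc 0 a) :=
      ((SS_cont hQ hc hM hQM h1M).mul (SS_cont hc hQ hM h1M hQM)).sub
        ((TT_cont hQ hc hM hQM h1M).mul (TT_cont hc hQ hM h1M hQM))
    have hE : EqOn W (fun _ => W x) (Icc 0 a) :=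
      EqOn.of_subset_closure (s := Ioo 0 a)
        (fun y hy => const_of_deriv hWd y hy x hx) hWc continuousOn_const sub
        (by rw [closure_Ioo ha.ne])
    have h0 : W 0 = W x := hE ⟨le_rfl, ha.le⟩
    have : W 0 = 1 := by simp [hW, SS_zero, TT_zero]
    change W x = 1
    rw [← h0, this]

/-- general solution of the Schrödinger equation: every twice
differentiable u on (0,a) with −u'' + q u = 0 equals c₁ u₁ + c₂ u₂ on (0,a) for
unique complex constants c₁, c₂; conversely, every such combination satisfies
−u'' + q u = 0 on (0,a). -/
theorem stmt_10 (a : ℝ) (ha : 0 < a) (q : ℝ → ℂ) (hq : ContinuousOn q (Set.Icc 0 a)) :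
    (∀ u : ℝ → ℂ,
      (∀ x ∈ Set.Ioo 0 a, DifferentiableAt ℝ u x ∧ DifferentiableAt ℝ (deriv u) x) →
      (∀ x ∈ Set.Ioo 0 a, -(deriv (deriv u) x) + q x * u x = 0) →
      ∃! c : ℂ × ℂ, ∀ x ∈ Set.Ioo 0 a, u x = c.1 * u₁ q x + c.2 * u₂ q x) ∧
    ∀ c₁ c₂ : ℂ, ∀ x ∈ Set.Ioo 0 a,
      -(deriv (deriv (fun y => c₁ * u₁ q y + c₂ * u₂ q y)) x) +
        q x * (c₁ * u₁ q x + c₂ * u₂ q x) = 0 := by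
  obtain ⟨d₁, d₂, h1, h2, h1', h2', hW⟩ := key a ha q hq
  constructor
  · intro u hu hode
    have hm : a / 2 ∈ Ioo 0 a := ⟨by linarith, by linarith⟩
    have k1 : ∀ x ∈ Ioo 0 a, HasDerivAt (fun x => u x * d₂ x - deriv u x * u₂ q x) 0 x := by
      intro x hx
      have A := (hu x hx).1.hasDerivAt
      have B := (hu x hx).2.hasDerivAt
      have := (A.mul (h2' x hx)).sub (B.mul (h2 x hx))
      refine HasDerivAt.congr_deriv this ?_
      linear_combination (u₂ q x) * hode x hx
    have k2 : ∀ x ∈ Ioo 0 a, HasDerivAt (fun x => u₁ q x * deriv u x - d₁ x * u x) 0 x := by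
      intro x hx
      have A := (hu x hx).1.hasDerivAt
      have B := (hu x hx).2.hasDerivAt
      have := ((h1 x hx).mul B).sub ((h1' x hx).mul A)
      refine HasDerivAt.congr_deriv this ?_
      linear_combination (-u₁ q x) * hode x hx
    refine ⟨(u (a/2) * d₂ (a/2) - deriv u (a/2) * u₂ q (a/2),
      u₁ q (a/2) * deriv u (a/2) - d₁ (a/2) * u (a/2)), ?_, ?_⟩
    · intro x hx
      have e1 := const_of_deriv k1 x hx _ hm
      have e2 := const_of_deriv k2 x hx _ hm
      simp only at e1 e2 ⊢
      rw [← e1, ← e2]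
      linear_combination (-u x) * hW x hx
    · rintro ⟨c1, c2⟩ hc
      simp only at hc
      have hd : deriv u (a/2) = c1 * d₁ (a/2) + c2 * d₂ (a/2) := by
        have : HasDerivAt u (c1 * d₁ (a/2) + c2 * d₂ (a/2)) (a/2) := by
          refine (((h1 _ hm).const_mul c1).add ((h2 _ hm).const_mul c2)).congr_of_eventuallyEq ?_
          filter_upwards [isOpen_Ioo.mem_nhds hm] with y hy using hc y hy
        exact this.deriv
      rw [hd, hc _ hm]
      have := hW _ hm
      ext1
      · simp only
        linear_combination (-c1) * this
      · simp only
        linear_combination (-c2) * this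
  · intro c₁ c₂ x hx
    have hd : HasDerivAt (deriv (fun y => c₁ * u₁ q y + c₂ * u₂ q y))
        (c₁ * (q x * u₁ q x) + c₂ * (q x * u₂ q x)) x := by
      refine (((h1' _ hx).const_mul c₁).add ((h2' _ hx).const_mul c₂)).congr_of_eventuallyEq ?_
      filter_upwards [isOpen_Ioo.mem_nhds hx] with y hy
      exact (((h1 _ hy).const_mul c₁).add ((h2 _ hy).const_mul c₂)).deriv
    rw [hd.deriv]
    ring
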